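/- arXiv:2011.00276 — 4 statements merged into one kernel-verified Lean document; each statement's English description precedes it below -/
import Mathlib

section
/- Continuity of the ground state level on the line: let p ∈ (2,6) and α > 0. The map μ ↦ ℰ_α(μ, ℝ), extended by the value 0 at μ = 0, is continuous on [0, μ_ℝ); in particular ℰ_α(μ, ℝ) → 0 as μ → 0⁺, and ℰ_α(μₙ, ℝ) → ℰ_α(μ, ℝ) whenever μₙ → μ with μ, μₙ ∈ (0, μ_ℝ). -/
open MeasureTheory Real Set Filter

/-- Membership in `H¹(ℝ)`: `u` is differentiable with derivative `u'`,
and both `u` and `u'` are square-integrable on `ℝ`. -/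
def H1line (u u' : ℝ → ℝ) : Prop :=
  (∀ x, HasDerivAt u (u' x) x) ∧
  Integrable (fun x => (u x) ^ 2) ∧
  Integrable (fun x => (u' x) ^ 2)

/-- The NLS energy with combined nonlinearities on the line. -/
noncomputable def Eline (p α : ℝ) (u u' : ℝ → ℝ) : ℝ :=
  ∫ x, (1 / 2 * (u' x) ^ 2 - 1 / 6 * |u x| ^ 6 - α / p * |u x| ^ p)

/-- The ground state energy level `ℰ_α(μ, ℝ)`. -/
noncomputable def glevelLine (p α μ : ℝ) : ℝ :=
  sInf {e : ℝ | ∃ u u' : ℝ → ℝ, H1line u u' ∧ (∫ x, (u x) ^ 2) = μ ∧ Eline p α u u' = e}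

lemma H1line.continuous {u u' : ℝ → ℝ} (h : H1line u u') : Continuous u :=
  continuous_iff_continuousAt.2 fun x => (h.1 x).continuousAt

lemma H1line.measurable_deriv {u u' : ℝ → ℝ} (h : H1line u u') : Measurable u' := by
  rw [show u' = deriv u from funext fun x => ((h.1 x).deriv).symm]
  exact _root_.measurable_deriv u

lemma H1line.integrable_mul {u u' : ℝ → ℝ} (h : H1line u u') :
    Integrable (fun x => u x * u' x) := by
  refine (h.2.1.add h.2.2).mono'
    (h.continuous.measurable.mul h.measurable_deriv).aestronglyMeasurable (ae_of_all _ fun x => ?_)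
  simp only [Pi.add_apply, norm_eq_abs]
  exact abs_le.2 ⟨by nlinarith [sq_nonneg (u x + u' x), sq_nonneg (u x), sq_nonneg (u' x)],
    by nlinarith [sq_nonneg (u x - u' x), sq_nonneg (u x), sq_nonneg (u' x)]⟩

lemma H1line.hasDerivAt_sq {u u' : ℝ → ℝ} (h : H1line u u') (x : ℝ) :
    HasDerivAt (fun x => (u x) ^ 2) (2 * (u x * u' x)) x := by
  convert! (h.1 x).pow 2 using 1
  ring

lemma H1line.tendsto_sq_atTop {u u' : ℝ → ℝ} (h : H1line u u') :
    Tendsto (fun x => (u x) ^ 2) atTop (nhds 0) :=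
  tendsto_zero_of_hasDerivAt_of_integrableOn_Ioi (a := 0) (fun x _ => h.hasDerivAt_sq x)
    (h.integrable_mul.const_mul 2).integrableOn h.2.1.integrableOn

lemma H1line.tendsto_sq_atBot {u u' : ℝ → ℝ} (h : H1line u u') :
    Tendsto (fun x => (u x) ^ 2) atBot (nhds 0) :=
  tendsto_zero_of_hasDerivAt_of_integrableOn_Iic (a := 0) (fun x _ => h.hasDerivAt_sq x)
    (h.integrable_mul.const_mul 2).integrableOn h.2.1.integrableOn

lemma H1line.exists_bound {u u' : ℝ → ℝ} (h : H1line u u') : ∃ B, ∀ x, (u x) ^ 2 ≤ B := by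
  refine ⟨∫ x, |2 * (u x * u' x)|, fun x => ?_⟩
  have hi := h.integrable_mul.const_mul 2
  have key := integral_Iic_of_hasDerivAt_of_tendsto' (fun y (_ : y ∈ Iic x) => h.hasDerivAt_sq y)
    hi.integrableOn h.tendsto_sq_atBot
  rw [sub_zero] at key
  rw [← key]
  calc ∫ y in Iic x, 2 * (u y * u' y)
      ≤ ∫ y in Iic x, |2 * (u y * u' y)| :=
        setIntegral_mono hi.integrableOn hi.abs.integrableOn fun y => le_abs_self _
    _ ≤ ∫ y, |2 * (u y * u' y)| :=
        setIntegral_le_integral hi.abs (ae_of_all _ fun y => abs_nonneg _)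

/-- Interpolation of `|y| ^ p` between `y ^ 2` and `|y| ^ 6`. -/
lemma abs_rpow_le_interp {p R : ℝ} (hp : 2 < p) (hp' : p < 6) (hR : 0 < R) (y : ℝ) :
    |y| ^ p ≤ R ^ (p - 6) * |y| ^ 6 + R ^ (p - 2) * y ^ 2 := by
  rcases eq_or_ne y 0 with rfl | hy
  · rw [abs_zero, Real.zero_rpow (by linarith)]
    simp
  have hy : 0 < |y| := abs_pos.2 hy
  rw [← sq_abs y]
  rcases le_total |y| R with h | h
  · have h1 : |y| ^ p = |y| ^ (p - 2) * |y| ^ 2 := by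
      rw [← Real.rpow_natCast, ← Real.rpow_add hy]; norm_num
    have h2 : |y| ^ (p - 2) ≤ R ^ (p - 2) :=
      Real.rpow_le_rpow hy.le h (by linarith)
    have h3 : 0 ≤ R ^ (p - 6) * |y| ^ 6 := by positivity
    rw [h1]
    nlinarith [mul_le_mul_of_nonneg_right h2 (sq_nonneg |y|)]
  · have h1 : |y| ^ p = |y| ^ (p - 6) * |y| ^ 6 := by
      rw [← Real.rpow_natCast, ← Real.rpow_add hy]; norm_num
    have h2 : |y| ^ (p - 6) ≤ R ^ (p - 6) :=
      Real.rpow_le_rpow_of_nonpos hR h (by linarith)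
    have h3 : 0 ≤ R ^ (p - 2) * |y| ^ 2 := by positivity
    rw [h1]
    nlinarith [mul_le_mul_of_nonneg_right h2 (pow_nonneg hy.le 6)]

lemma H1line.integrable_abs_pow_six {u u' : ℝ → ℝ} (h : H1line u u') :
    Integrable (fun x => |u x| ^ 6) := by
  obtain ⟨B, hB⟩ := h.exists_bound
  refine (h.2.1.const_mul (B ^ 2)).mono' (by have := h.continuous; fun_prop)
    (ae_of_all _ fun x => ?_)
  rw [norm_pow, norm_eq_abs, abs_abs]
  have h1 := pow_le_pow_left₀ (sq_nonneg (u x)) (hB x) 2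
  calc |u x| ^ 6 = ((u x) ^ 2) ^ 2 * (u x) ^ 2 := by rw [← sq_abs (u x)]; ring
    _ ≤ B ^ 2 * (u x) ^ 2 := by gcongr

lemma H1line.integrable_abs_rpow {u u' : ℝ → ℝ} (h : H1line u u') {p : ℝ}
    (hp : 2 < p) (hp' : p < 6) : Integrable (fun x => |u x| ^ p) := by
  refine ((h.integrable_abs_pow_six.const_mul ((1 : ℝ) ^ (p - 6))).add
    (h.2.1.const_mul ((1 : ℝ) ^ (p - 2)))).mono'
    ((h.continuous.abs.rpow_const fun x => Or.inr (by linarith)).aestronglyMeasurable)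
    (ae_of_all _ fun x => ?_)
  rw [norm_of_nonneg (by positivity)]
  exact abs_rpow_le_interp hp hp' one_pos (u x)

lemma eline_eq {u u' : ℝ → ℝ} (h : H1line u u') {p : ℝ} (α : ℝ)
    (hp : 2 < p) (hp' : p < 6) :
    Eline p α u u' = 1 / 2 * (∫ x, (u' x) ^ 2) - 1 / 6 * (∫ x, |u x| ^ 6)
      - α / p * ∫ x, |u x| ^ p := by
  have h6 := h.integrable_abs_pow_six.const_mul (1 / 6)
  have h2 := h.2.2.const_mul (1 / 2)
  have h26 : Integrable fun x => 1 / 2 * (u' x) ^ 2 - 1 / 6 * |u x| ^ 6 := h2.sub h6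
  rw [Eline, integral_sub h26 ((h.integrable_abs_rpow hp hp').const_mul _), integral_sub h2 h6]
  simp only [integral_const_mul]

lemma H1line.const_mul {u u' : ℝ → ℝ} (h : H1line u u') (c : ℝ) :
    H1line (fun x => c * u x) (fun x => c * u' x) := by
  refine ⟨fun x => (h.1 x).const_mul c, ?_, ?_⟩
  · simpa only [mul_pow] using h.2.1.const_mul (c ^ 2)
  · simpa only [mul_pow] using h.2.2.const_mul (c ^ 2)

lemma eline_sqrt_mul {u u' : ℝ → ℝ} (h : H1line u u') {p : ℝ} (α : ℝ)
    (hp : 2 < p) (hp' : p < 6) {t : ℝ} (ht : 0 ≤ t) :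
    Eline p α (fun x => √t * u x) (fun x => √t * u' x) =
      t * (1 / 2 * ∫ x, (u' x) ^ 2) - t ^ 3 * (1 / 6 * ∫ x, |u x| ^ 6)
      - t ^ (p / 2) * (α / p * ∫ x, |u x| ^ p) := by
  rw [eline_eq (h.const_mul _) α hp hp']
  have h1 : ∀ x, |√t * u x| ^ p = t ^ (p / 2) * |u x| ^ p := fun x => by
    rw [abs_mul, abs_of_nonneg (Real.sqrt_nonneg t), Real.mul_rpow (Real.sqrt_nonneg t)
      (abs_nonneg _), Real.sqrt_eq_rpow, ← Real.rpow_mul ht]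
    ring_nf
  have h2 : ∀ x, |√t * u x| ^ 6 = t ^ 3 * |u x| ^ 6 := fun x => by
    rw [abs_mul, abs_of_nonneg (Real.sqrt_nonneg t), mul_pow,
      show √t ^ 6 = (√t ^ 2) ^ 3 by ring, Real.sq_sqrt ht]
  simp only [h1, h2, mul_pow, Real.sq_sqrt ht, integral_const_mul]
  ring

/-- The sharp one-dimensional Gagliardo–Nirenberg inequality, with the mass replaced by
any strict upper bound of it. -/
lemma integral_abs_pow_six_le {u u' : ℝ → ℝ} (h : H1line u u') {M : ℝ}
    (hM : ∫ x, (u x) ^ 2 < M) :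
    (π / M) ^ 2 / 4 * ∫ x, |u x| ^ 6 ≤ ∫ x, (u' x) ^ 2 := by
  set μ := ∫ x, (u x) ^ 2 with hμ
  have hμ0 : 0 ≤ μ := integral_nonneg fun x => sq_nonneg _
  have hM0 : 0 < M := hμ0.trans_lt hM
  set l := π / M with hl
  have hl0 : 0 < l := div_pos pi_pos hM0
  set θ : ℝ → ℝ := fun x => l * ((∫ y in Iic x, (u y) ^ 2) - μ / 2) with hθ
  set A := l * (μ / 2) with hA
  have hApi : A < π / 2 := by
    rw [hA, hl, div_mul_eq_mul_div, div_lt_div_iff₀ hM0 two_pos]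
    nlinarith [pi_pos]
  have hθA : ∀ x, |θ x| ≤ A := fun x => by
    have h1 : 0 ≤ ∫ y in Iic x, (u y) ^ 2 := integral_nonneg fun x => sq_nonneg _
    have h2 : ∫ y in Iic x, (u y) ^ 2 ≤ μ :=
      setIntegral_le_integral h.2.1 (ae_of_all _ fun y => sq_nonneg _)
    rw [hθ, abs_mul, abs_of_pos hl0]
    exact mul_le_mul_of_nonneg_left (abs_le.2 ⟨by linarith, by linarith⟩) hl0.le
  have hθmem : ∀ x, θ x ∈ Ioo (-(π / 2)) (π / 2) := fun x =>
    ⟨by linarith [(abs_le.1 (hθA x)).1], by linarith [(abs_le.1 (hθA x)).2]⟩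
  have hcos : ∀ x, cos (θ x) ≠ 0 := fun x => (cos_pos_of_mem_Ioo (hθmem x)).ne'
  have hA0 : 0 ≤ A := by positivity
  have htan : ∀ x, |tan (θ x)| ≤ tan A := fun x => by
    have hmem : A ∈ Ioo (-(π / 2)) (π / 2) := ⟨by linarith, hApi⟩
    have hmem' : -A ∈ Ioo (-(π / 2)) (π / 2) := ⟨by linarith, by linarith⟩
    refine abs_le.2 ⟨?_, ?_⟩
    · rw [← tan_neg]
      exact strictMonoOn_tan.monotoneOn hmem' (hθmem x) (abs_le.1 (hθA x)).1
    · exact strictMonoOn_tan.monotoneOn (hθmem x) hmem (abs_le.1 (hθA x)).2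
  have hθd : ∀ x, HasDerivAt θ (l * (u x) ^ 2) x := fun x => by
    have hc : Continuous fun y => (u y) ^ 2 := h.continuous.pow 2
    have h1 : ∀ b, ∫ y in Iic b, (u y) ^ 2 =
        (∫ y in Iic (0 : ℝ), (u y) ^ 2) + ∫ y in (0 : ℝ)..b, (u y) ^ 2 := fun b => by
      rw [← intervalIntegral.integral_Iic_sub_Iic h.2.1.integrableOn h.2.1.integrableOn]
      ring
    have h2 : HasDerivAt (fun b => ∫ y in Iic b, (u y) ^ 2) ((u x) ^ 2) x := by
      rw [funext h1]
      exact (intervalIntegral.integral_hasDerivAt_right (hc.intervalIntegrable _ _)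
        (hc.stronglyMeasurableAtFilter _ _) hc.continuousAt).const_add _
    exact (h2.sub_const _).const_mul l
  have hθc : Continuous fun x => tan (θ x) :=
    continuous_iff_continuousAt.2 fun x =>
      ((hasDerivAt_tan (hcos x)).comp x (hθd x)).continuousAt
  have hcont := h.continuous
  obtain ⟨B, hB⟩ := h.exists_bound
  have hF : ∀ x, HasDerivAt (fun x => ((u x) ^ 2) ^ 2 * tan (θ x))
      (4 * ((u x) ^ 2 * tan (θ x)) * (u x * u' x)
        + l * (|u x| ^ 6 + (tan (θ x)) ^ 2 * |u x| ^ 6)) x := fun x => by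
    convert! ((h.hasDerivAt_sq x).pow 2).mul ((hasDerivAt_tan (hcos x)).comp x (hθd x)) using 1
    have h6 : |u x| ^ 6 = (u x) ^ 6 := Even.pow_abs (by decide) _
    have h1 : 1 / cos (θ x) ^ 2 = 1 + tan (θ x) ^ 2 := by
      
      rw [← inv_one_add_tan_sq (hcos x), one_div, inv_inv]
    simp only [Function.comp_apply, Pi.pow_apply, h1, h6]
    ring
  have hint1 : Integrable fun x => 4 * ((u x) ^ 2 * tan (θ x)) * (u x * u' x) := by
    refine h.integrable_mul.bdd_mul (c := 4 * (B * tan A)) (by fun_prop) (ae_of_all _ fun x => ?_)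
    rw [norm_eq_abs, abs_mul, abs_mul, abs_of_nonneg (sq_nonneg (u x)), abs_of_pos four_pos]
    have := (sq_nonneg (u x)).trans (hB x)
    gcongr
    exacts [hB x, htan x]
  have hint2 : Integrable fun x => (tan (θ x)) ^ 2 * |u x| ^ 6 := by
    refine h.integrable_abs_pow_six.bdd_mul (c := tan A ^ 2) (hθc.pow 2).aestronglyMeasurable
      (ae_of_all _ fun x => ?_)
    rw [norm_pow, norm_eq_abs]
    gcongr
    exact htan x
  have hFint : Integrable fun x => 4 * ((u x) ^ 2 * tan (θ x)) * (u x * u' x)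
      + l * (|u x| ^ 6 + (tan (θ x)) ^ 2 * |u x| ^ 6) :=
    hint1.add ((h.integrable_abs_pow_six.add hint2).const_mul l)
  have hlim : ∀ L : Filter ℝ, Tendsto (fun x => (u x) ^ 2) L (nhds 0) →
      Tendsto (fun x => ((u x) ^ 2) ^ 2 * tan (θ x)) L (nhds 0) := fun L hL => by
    refine Tendsto.zero_mul_isBoundedUnder_le (by simpa using hL.pow 2) ?_
    exact isBoundedUnder_of ⟨tan A, fun x => htan x⟩
  have hzero := integral_of_hasDerivAt_of_tendsto hF hFint
    (hlim _ h.tendsto_sq_atBot) (hlim _ h.tendsto_sq_atTop)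
  rw [sub_zero] at hzero
  have hpos : 0 ≤ ∫ x, ((u' x) ^ 2 - l ^ 2 / 4 * |u x| ^ 6
      + l / 4 * (4 * ((u x) ^ 2 * tan (θ x)) * (u x * u' x)
        + l * (|u x| ^ 6 + (tan (θ x)) ^ 2 * |u x| ^ 6))) := by
    refine integral_nonneg fun x => ?_
    have h6 : |u x| ^ 6 = (u x) ^ 6 := Even.pow_abs (by decide) _
    have h1 := sq_nonneg (u' x + l / 2 * (u x) ^ 3 * tan (θ x))
    simp only [Pi.zero_apply, h6]
    nlinarith [h1]
  have hi6 := h.integrable_abs_pow_six.const_mul (l ^ 2 / 4)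
  have hi26 : Integrable fun x => (u' x) ^ 2 - l ^ 2 / 4 * |u x| ^ 6 := h.2.2.sub hi6
  rw [integral_add hi26 (hFint.const_mul (l / 4)), integral_sub h.2.2 hi6,
    integral_const_mul, integral_const_mul, hzero] at hpos
  linarith

lemma exists_eline_ge {p α M : ℝ} (hp : 2 < p) (hp' : p < 6) (hα : 0 < α) (hM0 : 0 < M)
    (hM : M < π * √3 / 2) :
    ∃ C, ∀ u u' : ℝ → ℝ, H1line u u' → ∫ x, (u x) ^ 2 < M →
      -(C * ∫ x, (u x) ^ 2) ≤ Eline p α u u' := by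
  have hp0 : 0 < p := by linarith
  have hgap : 0 < (π / M) ^ 2 / 8 - 1 / 6 := by
    have h1 : M ^ 2 < (π * √3 / 2) ^ 2 := by gcongr
    rw [div_pow, mul_pow, Real.sq_sqrt (by norm_num)] at h1
    rw [div_pow, sub_pos, div_div, div_lt_div_iff₀ (by norm_num) (by positivity)]
    linarith
  obtain ⟨R, hR, hR0⟩ : ∃ R : ℝ, α / p * R ^ (p - 6) < (π / M) ^ 2 / 8 - 1 / 6 ∧ 0 < R := by
    have h1 : Tendsto (fun R : ℝ => α / p * R ^ (p - 6)) atTop (nhds 0) := by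
      have := (tendsto_rpow_neg_atTop (show 0 < 6 - p by linarith)).const_mul (α / p)
      simpa using this
    exact ((h1.eventually_lt_const hgap).and (eventually_gt_atTop 0)).exists
  refine ⟨α / p * R ^ (p - 2), fun u u' h hmass => ?_⟩
  have hGN := integral_abs_pow_six_le h hmass
  have hI : ∫ x, |u x| ^ p ≤
      R ^ (p - 6) * (∫ x, |u x| ^ 6) + R ^ (p - 2) * ∫ x, (u x) ^ 2 := by
    have h6 := h.integrable_abs_pow_six.const_mul (R ^ (p - 6))
    have h2 := h.2.1.const_mul (R ^ (p - 2))
    rw [← integral_const_mul, ← integral_const_mul, ← integral_add h6 h2]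
    exact integral_mono (h.integrable_abs_rpow hp hp') (h6.add h2)
      fun x => abs_rpow_le_interp hp hp' hR0 (u x)
  have hS : 0 ≤ ∫ x, |u x| ^ 6 := integral_nonneg fun x => by positivity
  have h3 := mul_le_mul_of_nonneg_left hI (show 0 ≤ α / p by positivity)
  have h4 := mul_le_mul_of_nonneg_right hR.le hS
  rw [eline_eq h α hp hp']
  linarith

/-- `H¹(ℝ)` contains a function of positive mass. -/
lemma exists_H1line_pos : ∃ u u' : ℝ → ℝ, H1line u u' ∧ 0 < ∫ x, (u x) ^ 2 := by
  have hpos : ∀ x : ℝ, 0 < 1 + x ^ 2 := fun x => by positivity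
  have hi : Integrable fun x : ℝ => ((1 + x ^ 2)⁻¹) ^ 2 := by
    refine integrable_inv_one_add_sq.mono' (by fun_prop) (ae_of_all _ fun x => ?_)
    have h1 : (1 + x ^ 2)⁻¹ ≤ 1 := inv_le_one_of_one_le₀ (by nlinarith [sq_nonneg x])
    have h2 : 0 ≤ (1 + x ^ 2)⁻¹ := (inv_pos.2 (hpos x)).le
    rw [norm_of_nonneg (by positivity)]
    nlinarith
  refine ⟨fun x => (1 + x ^ 2)⁻¹, fun x => -(2 * x) / (1 + x ^ 2) ^ 2, ⟨fun x => ?_, hi, ?_⟩, ?_⟩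
  · have h1 : HasDerivAt (fun x : ℝ => 1 + x ^ 2) (2 * x) x := by
      simpa using (hasDerivAt_pow 2 x).const_add 1
    exact h1.fun_inv (hpos x).ne'
  · refine (hi.const_mul 4).mono' (Measurable.aestronglyMeasurable (by fun_prop))
      (ae_of_all _ fun x => ?_)
    rw [norm_of_nonneg (by positivity), div_pow, inv_pow, ← div_eq_mul_inv,
      div_le_div_iff₀ (by positivity) (by positivity)]
    have h1 : x ^ 2 ≤ (1 + x ^ 2) ^ 2 := by nlinarith [sq_nonneg x, sq_nonneg (x ^ 2)]
    nlinarith [mul_le_mul_of_nonneg_right h1 (sq_nonneg (1 + x ^ 2))]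
  · refine integral_pos_of_integrable_nonneg_nonzero (x := 0) ?_ hi (fun x => by positivity)
      (by simp)
    exact ((continuous_const.add (continuous_id.pow 2)).inv₀ fun x => (hpos x).ne').pow 2

/-- The energies of the functions of mass `μ`. -/
def energySet (p α μ : ℝ) : Set ℝ :=
  {e : ℝ | ∃ u u' : ℝ → ℝ, H1line u u' ∧ (∫ x, (u x) ^ 2) = μ ∧ Eline p α u u' = e}

lemma integral_sqrt_mul_sq (u : ℝ → ℝ) {t : ℝ} (ht : 0 ≤ t) :
    ∫ x, (√t * u x) ^ 2 = t * ∫ x, (u x) ^ 2 := by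
  simp only [mul_pow, Real.sq_sqrt ht, integral_const_mul]

lemma exists_mem_energySet_le {p α : ℝ} (hp : 2 < p) (hp' : p < 6) (hα : 0 < α) :
    ∃ D, ∀ μ, 0 < μ → ∃ e ∈ energySet p α μ, e ≤ D * μ := by
  obtain ⟨u, u', h, hm⟩ := exists_H1line_pos
  set m := ∫ x, (u x) ^ 2
  have hp0 : 0 < p := by linarith
  have hS : 0 ≤ ∫ x, |u x| ^ 6 := integral_nonneg fun x => by positivity
  have hP : 0 ≤ ∫ x, |u x| ^ p := integral_nonneg fun x => by positivity
  refine ⟨1 / 2 * (∫ x, (u' x) ^ 2) / m, fun μ hμ => ?_⟩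
  have ht : 0 ≤ μ / m := by positivity
  refine ⟨_, ⟨_, _, h.const_mul √(μ / m), ?_, rfl⟩, ?_⟩
  · rw [integral_sqrt_mul_sq u ht]
    exact div_mul_cancel₀ _ hm.ne'
  · rw [eline_sqrt_mul h α hp hp' ht]
    have h1 : 0 ≤ (μ / m) ^ 3 * (1 / 6 * ∫ x, |u x| ^ 6) := by positivity
    have h2 : 0 ≤ (μ / m) ^ (p / 2) * (α / p * ∫ x, |u x| ^ p) := by positivity
    have h3 : μ / m * (1 / 2 * ∫ x, (u' x) ^ 2) = 1 / 2 * (∫ x, (u' x) ^ 2) / m * μ := by ring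
    linarith

lemma bddBelow_energySet {p α μ : ℝ} (hp : 2 < p) (hp' : p < 6) (hα : 0 < α) (hμ0 : 0 < μ)
    (hμ : μ < π * √3 / 2) : BddBelow (energySet p α μ) := by
  obtain ⟨M, h1, h2⟩ := exists_between hμ
  obtain ⟨C, hC⟩ := exists_eline_ge hp hp' hα (hμ0.trans h1) h2
  refine ⟨-(C * μ), ?_⟩
  rintro e ⟨u, u', h, hm, rfl⟩
  have := hC u u' h (by rwa [hm])
  rwa [hm] at this

lemma concaveOn_glevelLine {p α : ℝ} (hp : 2 < p) (hp' : p < 6) (hα : 0 < α) :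
    ConcaveOn ℝ (Ioo 0 (π * √3 / 2)) (glevelLine p α) := by
  refine ⟨convex_Ioo _ _, fun x hx y hy a b ha hb hab => ?_⟩
  have hz := convex_Ioo (0 : ℝ) (π * √3 / 2) hx hy ha hb hab
  simp only [smul_eq_mul] at hz ⊢
  set z := a * x + b * y with hzdef
  obtain ⟨D, hD⟩ := exists_mem_energySet_le hp hp' hα
  obtain ⟨e₀, he₀, -⟩ := hD z hz.1
  refine le_csInf ⟨e₀, he₀⟩ ?_
  rintro e ⟨u, u', h, hm, rfl⟩
  have hp0 : 0 < p := by linarith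
  have hS : 0 ≤ 1 / 6 * ∫ x, |u x| ^ 6 :=
    mul_nonneg (by norm_num) (integral_nonneg fun x => by positivity)
  have hP : 0 ≤ α / p * ∫ x, |u x| ^ p :=
    mul_nonneg (by positivity) (integral_nonneg fun x => by positivity)
  have hle : ∀ w ∈ Ioo 0 (π * √3 / 2), glevelLine p α w ≤
      w / z * (1 / 2 * ∫ x, (u' x) ^ 2) - (w / z) ^ 3 * (1 / 6 * ∫ x, |u x| ^ 6)
      - (w / z) ^ (p / 2) * (α / p * ∫ x, |u x| ^ p) := fun w hw => by
    have ht : 0 ≤ w / z := (div_pos hw.1 hz.1).le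
    rw [← eline_sqrt_mul h α hp hp' ht]
    refine csInf_le (bddBelow_energySet hp hp' hα hw.1 hw.2) ⟨_, _, h.const_mul _, ?_, rfl⟩
    rw [integral_sqrt_mul_sq u ht, hm]
    exact div_mul_cancel₀ _ hz.1.ne'
  have hs : 0 ≤ x / z := (div_pos hx.1 hz.1).le
  have ht : 0 ≤ y / z := (div_pos hy.1 hz.1).le
  have hone : a * (x / z) + b * (y / z) = 1 := by
    rw [← mul_div_assoc, ← mul_div_assoc, ← add_div, ← hzdef, div_self hz.1.ne']
  have h3 : 1 ≤ a * (x / z) ^ 3 + b * (y / z) ^ 3 := by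
    have := (convexOn_pow 3).2 (mem_Ici.2 hs) (mem_Ici.2 ht) ha hb hab
    simpa only [smul_eq_mul, hone, one_pow] using this
  have hpp : 1 ≤ a * (x / z) ^ (p / 2) + b * (y / z) ^ (p / 2) := by
    have := (convexOn_rpow (show 1 ≤ p / 2 by linarith)).2 (mem_Ici.2 hs) (mem_Ici.2 ht) ha hb hab
    simpa only [smul_eq_mul, hone, Real.one_rpow] using this
  have hX := mul_le_mul_of_nonneg_left (hle x hx) ha
  have hY := mul_le_mul_of_nonneg_left (hle y hy) hb
  have hS' := mul_le_mul_of_nonneg_right h3 hS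
  have hP' := mul_le_mul_of_nonneg_right hpp hP
  rw [eline_eq h α hp hp']
  linear_combination hX + hY + hS' + hP' + (1 / 2 * ∫ x, (u' x) ^ 2) * hone

lemma tendsto_glevelLine_zero {p α : ℝ} (hp : 2 < p) (hp' : p < 6) (hα : 0 < α) :
    Tendsto (glevelLine p α) (nhdsWithin 0 (Ioi 0)) (nhds 0) := by
  have hpos : 0 < π * √3 / 2 := by positivity
  obtain ⟨M, hM0, hM⟩ := exists_between hpos
  obtain ⟨C, hC⟩ := exists_eline_ge hp hp' hα hM0 hM
  obtain ⟨D, hD⟩ := exists_mem_energySet_le hp hp' hα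
  have hlin : ∀ c : ℝ, Tendsto (fun μ : ℝ => c * μ) (nhdsWithin 0 (Ioi 0)) (nhds 0) := fun c =>
    ((continuous_const_mul c).tendsto' 0 0 (mul_zero c)).mono_left nhdsWithin_le_nhds
  have hmem : ∀ᶠ μ in nhdsWithin (0 : ℝ) (Ioi 0), μ ∈ Ioo 0 M := Ioo_mem_nhdsGT hM0
  refine tendsto_of_tendsto_of_tendsto_of_le_of_le' (hlin (-C)) (hlin D) ?_ ?_
  · filter_upwards [hmem] with μ hμ
    obtain ⟨e₀, he₀, -⟩ := hD μ hμ.1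
    refine le_csInf ⟨e₀, he₀⟩ ?_
    rintro e ⟨u, u', h, hm, rfl⟩
    have := hC u u' h (by rw [hm]; exact hμ.2)
    rw [hm] at this
    linarith
  · filter_upwards [hmem] with μ hμ
    obtain ⟨e, he, hle⟩ := hD μ hμ.1
    exact (csInf_le (bddBelow_energySet hp hp' hα hμ.1 (hμ.2.trans hM)) he).trans hle

/-- Continuity of the ground state level on the line: for `p ∈ (2,6)` and `α > 0`,
the map `μ ↦ ℰ_α(μ, ℝ)`, extended by `0` at `μ = 0`, is continuous on `[0, μ_ℝ)`;
in particular `ℰ_α(μ, ℝ) → 0` as `μ → 0⁺`. -/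
theorem glevel_continuous_line (p α : ℝ)
    (hp : 2 < p) (hp' : p < 6) (hα : 0 < α) :
    ContinuousOn (fun μ : ℝ => if μ = 0 then 0 else glevelLine p α μ)
      (Set.Ico 0 (Real.pi * Real.sqrt 3 / 2)) ∧
    Filter.Tendsto (glevelLine p α) (nhdsWithin 0 (Set.Ioi 0)) (nhds 0) := by
  have hlim := tendsto_glevelLine_zero hp hp' hα
  refine ⟨fun μ hμ => ?_, hlim⟩
  rcases hμ.1.eq_or_lt with rfl | hμ0
  · have h0 : ContinuousWithinAt (fun μ : ℝ => if μ = 0 then 0 else glevelLine p α μ)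
        (Ioi 0) 0 := by
      rw [ContinuousWithinAt, if_pos rfl]
      refine hlim.congr' ?_
      filter_upwards [self_mem_nhdsWithin] with ν hν
      rw [if_neg (ne_of_gt hν)]
    exact (continuousWithinAt_Ioi_iff_Ici.1 h0).mono Ico_subset_Ici_self
  · have hcont := ((concaveOn_glevelLine hp hp' hα).continuousOn isOpen_Ioo).continuousAt
      (Ioo_mem_nhds hμ0 hμ.2)
    refine (hcont.congr ?_).continuousWithinAt
    filter_upwards [lt_mem_nhds hμ0] with ν hν
    rw [if_neg hν.ne']
end

section
/- Relaxed mass constraint on the line: let p ∈ (2,6), α > 0 and μ ∈ (0, μ_ℝ). Then the infimum of the NLS energy over the relaxed constraint set coincides with the ground state level, i.e. inf{E_α(u) : u ∈ H¹(ℝ), ∫_ℝ u² dx ≤ μ} = ℰ_α(μ, ℝ). -/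
open MeasureTheory Real Set Filter

theorem Real.sInf_eq_of_subset_of_forall_exists_le_add {S T : Set ℝ} (hTS : T ⊆ S)
    (hT : T.Nonempty) (h : ∀ e ∈ S, ∀ ε > 0, ∃ e' ∈ T, e' ≤ e + ε) : sInf S = sInf T := by
  by_cases hS : BddBelow S
  · refine le_antisymm (csInf_le_csInf hS hT hTS) (le_csInf (hT.mono hTS) fun e he => ?_)
    refine le_of_forall_pos_le_add fun ε hε => ?_
    obtain ⟨e', he', hle⟩ := h e he ε hε
    exact (csInf_le (hS.mono hTS) he').trans hle
  · have hT' : ¬ BddBelow T := by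
      rintro ⟨b, hb⟩
      refine hS ⟨b - 1, fun e he => ?_⟩
      obtain ⟨e', he', hle⟩ := h e he 1 one_pos
      linarith [hb he']
    rw [Real.sInf_of_not_bddBelow hS, Real.sInf_of_not_bddBelow hT']

/-- `H¹(ℝ)` is stable under amplitude scaling and dilation. -/
theorem H1line.comp_div {u u' : ℝ → ℝ} (h : H1line u u') (a : ℝ) {l : ℝ} (hl : 0 < l) :
    H1line (fun x => a * u (x / l)) (fun x => a / l * u' (x / l)) := by
  obtain ⟨hd, hu, hu'⟩ := h
  refine ⟨fun x => ?_, ?_, ?_⟩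
  · have : HasDerivAt (fun x => a * u (x / l)) (a * (u' (x / l) * (1 / l))) x :=
      ((hd (x / l)).comp x ((hasDerivAt_id x).div_const l)).const_mul a
    convert this using 1
    ring
  · simpa only [mul_pow] using (hu.comp_div hl.ne').const_mul (a ^ 2)
  · simpa only [mul_pow] using (hu'.comp_div hl.ne').const_mul ((a / l) ^ 2)

theorem integral_sq_const_mul_comp_div (f : ℝ → ℝ) (a : ℝ) {l : ℝ} (hl : 0 < l) :
    ∫ x, (a * f (x / l)) ^ 2 = a ^ 2 * l * ∫ x, f x ^ 2 := by
  simp only [mul_pow]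
  rw [integral_const_mul, Measure.integral_comp_div (fun x => f x ^ 2) l, abs_of_pos hl,
    smul_eq_mul, mul_assoc]

theorem Eline_le_kinetic {p α : ℝ} (hp : 0 < p) (hα : 0 < α) {u u' : ℝ → ℝ}
    (h : H1line u u') : Eline p α u u' ≤ 1 / 2 * ∫ x, u' x ^ 2 := by
  rw [Eline, ← integral_const_mul]
  by_cases hi : Integrable fun x => 1 / 2 * (u' x) ^ 2 - 1 / 6 * |u x| ^ 6 - α / p * |u x| ^ p
  · refine integral_mono hi (h.2.2.const_mul _) fun x => ?_
    have h1 : 0 ≤ 1 / 6 * |u x| ^ 6 := by positivity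
    have h2 : 0 ≤ α / p * |u x| ^ p := by positivity
    simp only
    linarith
  · rw [integral_undef hi]
    exact integral_nonneg fun x => by positivity

theorem H1line_gaussian :
    H1line (fun x => rexp (-(x ^ 2) / 2)) (fun x => -x * rexp (-(x ^ 2) / 2)) := by
  have hexp : ∀ x : ℝ, rexp (-(x ^ 2) / 2) ^ 2 = rexp (-1 * x ^ 2) := fun x => by
    rw [← Real.exp_nat_mul]
    congr 1
    push_cast
    ring
  refine ⟨fun x => ?_, ?_, ?_⟩
  · have : HasDerivAt (fun x : ℝ => rexp (-(x ^ 2) / 2))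
        (rexp (-(x ^ 2) / 2) * (-((2 : ℕ) * x ^ (2 - 1)) / 2)) x :=
      (((hasDerivAt_pow 2 x).neg).div_const 2).exp
    convert this using 1
    push_cast
    ring
  · simpa only [hexp] using integrable_exp_neg_mul_sq one_pos
  · have := integrable_rpow_mul_exp_neg_mul_sq (b := 1) one_pos (s := 2) (by norm_num)
    simpa only [mul_pow, hexp, neg_sq, Real.rpow_two] using this

/-- At every positive mass there are functions of arbitrarily small energy. -/
theorem exists_H1line_Eline_le {p α μ ε : ℝ} (hp : 0 < p) (hα : 0 < α) (hμ : 0 < μ)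
    (hε : 0 < ε) :
    ∃ u u' : ℝ → ℝ, H1line u u' ∧ (∫ x, (u x) ^ 2) = μ ∧ Eline p α u u' ≤ ε := by
  obtain ⟨u, u', h, hM⟩ : ∃ u u' : ℝ → ℝ, H1line u u' ∧ 0 < ∫ x, u x ^ 2 := by
    refine ⟨_, _, H1line_gaussian, ?_⟩
    rw [integral_pos_iff_support_of_nonneg (fun x => by positivity) H1line_gaussian.2.1]
    have : Function.support (fun x : ℝ => rexp (-(x ^ 2) / 2) ^ 2) = univ := by
      ext x
      simp [(Real.exp_pos _).ne']
    rw [this]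
    simp
  set M := ∫ x, u x ^ 2 with hMdef
  set K := ∫ x, u' x ^ 2 with hK
  have hK0 : 0 ≤ K := integral_nonneg fun x => by positivity
  set l := 1 + μ * K / (2 * M * ε) with hl
  have hl1 : 1 ≤ l := le_add_of_nonneg_right (by positivity)
  have hl0 : 0 < l := by linarith
  have ha : √(μ / (l * M)) ^ 2 = μ / (l * M) := Real.sq_sqrt (by positivity)
  have hv := h.comp_div (√(μ / (l * M))) hl0
  refine ⟨_, _, hv, ?_, (Eline_le_kinetic hp hα hv).trans ?_⟩
  · rw [integral_sq_const_mul_comp_div u _ hl0, ha, ← hMdef]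
    field_simp
  · rw [integral_sq_const_mul_comp_div u' _ hl0, div_pow, ha, ← hK]
    have hle : μ * K / (2 * M * ε) ≤ l ^ 2 := by nlinarith
    rw [div_le_iff₀ (by positivity)] at hle
    have : 1 / 2 * (μ / (l * M) / l ^ 2 * l * K) = μ * K / (2 * M * l ^ 2) := by
      field_simp
    rw [this, div_le_iff₀ (by positivity)]
    linarith

/-- A function of negative energy can be dilated to any larger mass without raising its energy. -/
theorem exists_H1line_Eline_le_of_neg {p α μ : ℝ} (hp : 0 < p) (hα : 0 < α) {u u' : ℝ → ℝ}
    (h : H1line u u') (hm : (∫ x, (u x) ^ 2) ≤ μ) (hE : Eline p α u u' < 0) :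
    ∃ v v' : ℝ → ℝ, H1line v v' ∧ (∫ x, (v x) ^ 2) = μ ∧ Eline p α v v' ≤ Eline p α u u' := by
  set G : ℝ → ℝ := fun x => 1 / 6 * |u x| ^ 6 + α / p * |u x| ^ p with hG
  have hGnn : ∀ x, 0 ≤ G x := fun x => by positivity
  have hEG : ∀ x, 1 / 2 * (u' x) ^ 2 - 1 / 6 * |u x| ^ 6 - α / p * |u x| ^ p
      = 1 / 2 * (u' x) ^ 2 - G x := fun x => by simp only [hG]; ring
  have hGi : Integrable G := by
    by_contra hi
    refine hE.ne (integral_undef fun hi' => hi ?_)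
    have := (h.2.2.const_mul (1 / 2)).sub hi'
    refine this.congr (.of_forall fun x => ?_)
    simp only [Pi.sub_apply, hEG]
    ring
  have hEu : Eline p α u u' = 1 / 2 * (∫ x, u' x ^ 2) - ∫ x, G x := by
    simp only [Eline, hEG]
    rw [integral_sub (h.2.2.const_mul _) hGi, integral_const_mul]
  have hK0 : 0 ≤ ∫ x, u' x ^ 2 := integral_nonneg fun x => by positivity
  have hm0 : 0 < ∫ x, u x ^ 2 := by
    refine (integral_nonneg fun x => by positivity).lt_of_ne' fun h0 => ?_
    rw [integral_eq_zero_iff_of_nonneg (fun x => by positivity) h.2.1] at h0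
    have hG0 : ∫ x, G x = 0 := by
      refine integral_eq_zero_of_ae (h0.mono fun x hx => ?_)
      have hx : u x = 0 := by simpa using hx
      simp [hG, hx, Real.zero_rpow hp.ne']
    rw [hEu, hG0] at hE
    linarith
  set l := μ / ∫ x, u x ^ 2 with hl
  have hl1 : 1 ≤ l := (one_le_div hm0).2 hm
  have hl0 : 0 < l := by linarith
  refine ⟨_, _, h.comp_div 1 hl0, ?_, ?_⟩
  · rw [integral_sq_const_mul_comp_div u _ hl0, hl]
    field_simp
  · have hEv : Eline p α (fun x => 1 * u (x / l)) (fun x => 1 / l * u' (x / l))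
        = 1 / 2 * ((1 / l) ^ 2 * l * ∫ x, u' x ^ 2) - l * ∫ x, G x := by
      rw [← integral_sq_const_mul_comp_div u' _ hl0, ← integral_const_mul]
      have hGl : l * ∫ x, G x = ∫ x, G (x / l) := by
        rw [Measure.integral_comp_div G l, abs_of_pos hl0, smul_eq_mul]
      rw [hGl, ← integral_sub ((h.comp_div 1 hl0).2.2.const_mul _) (hGi.comp_div hl0.ne'), Eline]
      refine integral_congr_ae (.of_forall fun x => ?_)
      simp only [hG, one_mul]
      ring
    rw [hEv, hEu]
    have hG0 : 0 ≤ ∫ x, G x := integral_nonneg hGnn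
    have hl2 : (1 / l) ^ 2 * l ≤ 1 := by
      have : (1 / l) ^ 2 * l = 1 / l := by field_simp
      rw [this]
      exact (div_le_one hl0).2 hl1
    nlinarith

/-- Relaxed mass constraint on the line: for `p ∈ (2,6)`, `α > 0` and `μ ∈ (0, μ_ℝ)`,
the infimum of `E_α` over `{u ∈ H¹(ℝ) : ∫ u² ≤ μ}` coincides with `ℰ_α(μ, ℝ)`. -/
theorem relaxed_constraint_level_line (p α μ : ℝ)
    (hp : 2 < p) (hp' : p < 6) (hα : 0 < α)
    (hμ : 0 < μ) (hμR : μ < Real.pi * Real.sqrt 3 / 2) :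
    sInf {e : ℝ | ∃ u u' : ℝ → ℝ, H1line u u' ∧ (∫ x, (u x) ^ 2) ≤ μ ∧
        Eline p α u u' = e} =
      glevelLine p α μ := by
  have hp0 : 0 < p := by linarith
  refine Real.sInf_eq_of_subset_of_forall_exists_le_add ?_ ?_ ?_
  · rintro e ⟨u, u', h, hm, he⟩
    exact ⟨u, u', h, hm.le, he⟩
  · obtain ⟨u, u', h, hm, -⟩ := exists_H1line_Eline_le hp0 hα hμ one_pos
    exact ⟨_, u, u', h, hm, rfl⟩
  · rintro e ⟨u, u', h, hm, rfl⟩ ε hε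
    rcases lt_or_ge (Eline p α u u') 0 with hE | hE
    · obtain ⟨v, v', hv, hvm, hle⟩ := exists_H1line_Eline_le_of_neg hp0 hα h hm hE
      exact ⟨_, ⟨v, v', hv, hvm, rfl⟩, by linarith⟩
    · obtain ⟨v, v', hv, hvm, hle⟩ := exists_H1line_Eline_le hp0 hα hμ hε
      exact ⟨_, ⟨v, v', hv, hvm, rfl⟩, by linarith⟩
end

section
/- Modified Gagliardo–Nirenberg inequality on the line: there exists a constant C > 0 such that for every μ ∈ (0, μ_ℝ] and every u ∈ H¹_μ(ℝ) there exists θ ∈ [0, μ] with ∫_ℝ |u|⁶ dx ≤ 3 ((μ − θ)/μ_ℝ)² ∫_ℝ |u'|² dx + C θ^{1/2}. -/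
open MeasureTheory Real Set Filter

namespace H1line

variable {u u' : ℝ → ℝ}

theorem continuous_s17 (h : H1line u u') : Continuous u :=
  continuous_iff_continuousAt.2 fun x => (h.1 x).continuousAt

theorem aestronglyMeasurable_deriv (h : H1line u u') : AEStronglyMeasurable u' := by
  have : u' = deriv u := funext fun x => (h.1 x).deriv.symm
  rw [this]
  exact _root_.aestronglyMeasurable_deriv u volume

theorem memLp_deriv (h : H1line u u') : MemLp u' 2 :=
  (memLp_two_iff_integrable_sq h.aestronglyMeasurable_deriv).2 h.2.2

theorem memLp (h : H1line u u') : MemLp u 2 :=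
  (memLp_two_iff_integrable_sq h.continuous_s17.aestronglyMeasurable).2 h.2.1

theorem hasDerivAt_sq_s17 (h : H1line u u') (x : ℝ) :
    HasDerivAt (fun y => u y ^ 2) (2 * (u x * u' x)) x := by
  exact ((h.1 x).pow 2).congr_deriv (by push_cast; ring)

theorem integrable_deriv_sq (h : H1line u u') : Integrable fun x => 2 * (u x * u' x) :=
  (h.memLp.integrable_mul h.memLp_deriv).const_mul 2

theorem tendsto_sq_atTop_s17 (h : H1line u u') : Tendsto (fun x => u x ^ 2) atTop (nhds 0) :=
  tendsto_zero_of_hasDerivAt_of_integrableOn_Ioi (a := 0) (fun x _ => h.hasDerivAt_sq_s17 x)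
    h.integrable_deriv_sq.integrableOn h.2.1.integrableOn

theorem tendsto_sq_atBot_s17 (h : H1line u u') : Tendsto (fun x => u x ^ 2) atBot (nhds 0) :=
  tendsto_zero_of_hasDerivAt_of_integrableOn_Iic (a := 0) (fun x _ => h.hasDerivAt_sq_s17 x)
    h.integrable_deriv_sq.integrableOn h.2.1.integrableOn

theorem exists_forall_sq_le (h : H1line u u') (hpos : 0 < ∫ x, u x ^ 2) :
    ∃ x₀, 0 < u x₀ ^ 2 ∧ ∀ x, u x ^ 2 ≤ u x₀ ^ 2 := by
  obtain ⟨y, hy⟩ : ∃ y, u y ≠ 0 := by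
    by_contra! h0
    simp [h0] at hpos
  have hy2 : 0 < u y ^ 2 := by positivity
  have hev : ∀ᶠ x in cocompact ℝ, u x ^ 2 ≤ u y ^ 2 := by
    rw [cocompact_eq_atBot_atTop, eventually_sup]
    exact ⟨h.tendsto_sq_atBot_s17.eventually_le_const hy2, h.tendsto_sq_atTop_s17.eventually_le_const hy2⟩
  obtain ⟨x₀, hx₀⟩ := (h.continuous_s17.pow 2).exists_forall_ge' y hev
  exact ⟨x₀, hy2.trans_le (hx₀ y), hx₀⟩

end H1line

theorem integral_sqrt_one_sub_sq_zero_one : ∫ t in (0 : ℝ)..1, √(1 - t ^ 2) = π / 4 := by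
  have hg_int (a b : ℝ) : IntervalIntegrable (fun t : ℝ => √(1 - t ^ 2)) volume a b :=
    (by fun_prop : Continuous fun t : ℝ => √(1 - t ^ 2)).intervalIntegrable a b
  have hadd := intervalIntegral.integral_add_adjacent_intervals (hg_int (-1) 0) (hg_int 0 1)
  have hneg : ∫ t in (-1 : ℝ)..0, √(1 - t ^ 2) = ∫ t in (0 : ℝ)..1, √(1 - t ^ 2) := by
    rw [← neg_zero (G := ℝ), ← intervalIntegral.integral_comp_neg, neg_zero]
    simp_rw [neg_sq]
  rw [integral_sqrt_one_sub_sq, hneg] at hadd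
  linarith

theorem sq_integral_abs_mul_le {f g : ℝ → ℝ} (hf : MemLp f 2) (hg : MemLp g 2) :
    (∫ x, |f x * g x|) ^ 2 ≤ (∫ x, f x ^ 2) * ∫ x, g x ^ 2 := by
  have hquad (k : ℝ) :
      0 ≤ (∫ x, f x ^ 2) * (k * k) + (-(2 * ∫ x, |f x * g x|)) * k + ∫ x, g x ^ 2 := by
    have hsum : ∫ x, (k * |f x| - |g x|) ^ 2 =
        (∫ x, f x ^ 2) * (k * k) + (-(2 * ∫ x, |f x * g x|)) * k + ∫ x, g x ^ 2 := by
      have hpt (x : ℝ) : (k * |f x| - |g x|) ^ 2 =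
          (k * k) * f x ^ 2 + (-(2 * k)) * |f x * g x| + g x ^ 2 := by
        rw [abs_mul, ← sq_abs (f x), ← sq_abs (g x)]
        ring
      simp_rw [hpt]
      have h₁ : Integrable fun x => (k * k) * f x ^ 2 := hf.integrable_sq.const_mul _
      have h₂ : Integrable fun x => (-(2 * k)) * |f x * g x| :=
        (hf.integrable_mul hg).abs.const_mul _
      have h₁₂ : Integrable fun x => (k * k) * f x ^ 2 + (-(2 * k)) * |f x * g x| := h₁.add h₂
      rw [integral_add h₁₂ hg.integrable_sq, integral_add h₁ h₂, integral_const_mul,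
        integral_const_mul]
      ring
    rw [← hsum]
    exact integral_nonneg fun x => sq_nonneg _
  have := discrim_le_zero hquad
  rw [discrim] at this
  linarith

namespace H1line

variable {u u' : ℝ → ℝ}

theorem memLp_sqrt_mul (h : H1line u u') (w : ℝ) :
    MemLp (fun x => √(1 - (u x ^ 2 / w) ^ 2) * (2 * u x / w)) 2 := by
  have hu := h.continuous_s17
  refine (h.memLp.const_mul (2 / w)).mono (by fun_prop) (Eventually.of_forall fun x => ?_)
  rw [norm_mul, show 2 / w * u x = 2 * u x / w by ring]
  refine mul_le_of_le_one_left (norm_nonneg _) ?_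
  rw [Real.norm_of_nonneg (Real.sqrt_nonneg _), Real.sqrt_le_iff]
  refine ⟨zero_le_one, ?_⟩
  nlinarith [sq_nonneg (u x ^ 2 / w)]

/-- The primitive of `√(1 - t²)` composed with `u² / max u²` climbs from `0` to `π / 4` and
descends back to `0`. -/
theorem pi_div_two_le_integral (h : H1line u u') {x₀ : ℝ} (hpos : 0 < u x₀ ^ 2) :
    π / 2 ≤ ∫ x, |√(1 - (u x ^ 2 / u x₀ ^ 2) ^ 2) * (2 * u x / u x₀ ^ 2) * u' x| := by
  set w := u x₀ ^ 2
  set G : ℝ → ℝ := fun s => ∫ t in (0 : ℝ)..s, √(1 - t ^ 2)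
  have hcont : Continuous fun t : ℝ => √(1 - t ^ 2) := by fun_prop
  have hG (s : ℝ) : HasDerivAt G (√(1 - s ^ 2)) s :=
    hcont.integral_hasStrictDerivAt 0 s |>.hasDerivAt
  have hderiv (x : ℝ) : HasDerivAt (fun y => G (u y ^ 2 / w))
      (√(1 - (u x ^ 2 / w) ^ 2) * (2 * u x / w) * u' x) x := by
    refine ((hG (u x ^ 2 / w)).comp x ((h.hasDerivAt_sq_s17 x).div_const w)).congr_deriv ?_
    ring
  have hg_int : Integrable fun x => √(1 - (u x ^ 2 / w) ^ 2) * (2 * u x / w) * u' x :=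
    (h.memLp_sqrt_mul w).integrable_mul h.memLp_deriv
  have hlim {l : Filter ℝ} (hl : Tendsto (fun x => u x ^ 2) l (nhds 0)) :
      Tendsto (fun x => G (u x ^ 2 / w)) l (nhds 0) := by
    have h0 : Tendsto G (nhds 0) (nhds 0) := by
      simpa [G] using (hG 0).continuousAt.tendsto
    exact h0.comp (by simpa using hl.div_const w)
  have hmax : G (u x₀ ^ 2 / w) = π / 4 := by
    rw [div_self hpos.ne']
    exact integral_sqrt_one_sub_sq_zero_one
  have hright := integral_Ioi_of_hasDerivAt_of_tendsto' (a := x₀) (fun x _ => hderiv x)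
    hg_int.integrableOn (hlim h.tendsto_sq_atTop_s17)
  have hleft := integral_Iic_of_hasDerivAt_of_tendsto' (a := x₀) (fun x _ => hderiv x)
    hg_int.integrableOn (hlim h.tendsto_sq_atBot_s17)
  rw [hmax] at hright hleft
  rw [← intervalIntegral.integral_Iic_add_Ioi hg_int.abs.integrableOn hg_int.abs.integrableOn (b := x₀)]
  have hr := neg_abs_le (∫ x in Ioi x₀, √(1 - (u x ^ 2 / w) ^ 2) * (2 * u x / w) * u' x)
  have hl := le_abs_self (∫ x in Iic x₀, √(1 - (u x ^ 2 / w) ^ 2) * (2 * u x / w) * u' x)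
  have hr' := abs_integral_le_integral_abs (μ := volume.restrict (Ioi x₀))
    (f := fun x => √(1 - (u x ^ 2 / w) ^ 2) * (2 * u x / w) * u' x)
  have hl' := abs_integral_le_integral_abs (μ := volume.restrict (Iic x₀))
    (f := fun x => √(1 - (u x ^ 2 / w) ^ 2) * (2 * u x / w) * u' x)
  linarith

theorem integral_sq_sqrt_mul (h : H1line u u') {w : ℝ} (hw : 0 < w) (hle : ∀ x, u x ^ 2 ≤ w) :
    ∫ x, (√(1 - (u x ^ 2 / w) ^ 2) * (2 * u x / w)) ^ 2 =
      4 / w ^ 2 * (∫ x, u x ^ 2) - 4 / w ^ 4 * ∫ x, |u x| ^ 6 := by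
  have hpt (x : ℝ) : (√(1 - (u x ^ 2 / w) ^ 2) * (2 * u x / w)) ^ 2 =
      4 / w ^ 2 * u x ^ 2 - 4 / w ^ 4 * |u x| ^ 6 := by
    have h1 : u x ^ 2 / w ≤ 1 := (div_le_one hw).2 (hle x)
    have h0 : 0 ≤ u x ^ 2 / w := by positivity
    rw [mul_pow, Real.sq_sqrt (by nlinarith), Even.pow_abs (by decide)]
    field_simp
    ring
  have hu := h.continuous_s17
  have h6 : Integrable fun x => |u x| ^ 6 := by
    refine (h.2.1.const_mul (w ^ 2)).mono (by fun_prop) (Eventually.of_forall fun x => ?_)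
    rw [Real.norm_of_nonneg (by positivity), Real.norm_of_nonneg (by positivity),
      Even.pow_abs (by decide), show u x ^ 6 = (u x ^ 2) ^ 2 * u x ^ 2 by ring]
    gcongr
    exact hle x
  simp_rw [hpt]
  rw [integral_sub (h.2.1.const_mul _) (h6.const_mul _), integral_const_mul, integral_const_mul]

/-- The sharp Gagliardo–Nirenberg inequality on the line. -/
theorem integral_abs_pow_six_le (h : H1line u u') (hpos : 0 < ∫ x, u x ^ 2) :
    ∫ x, |u x| ^ 6 ≤ 4 / π ^ 2 * (∫ x, u x ^ 2) ^ 2 * ∫ x, u' x ^ 2 := by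
  obtain ⟨x₀, hw, hle⟩ := h.exists_forall_sq_le hpos
  have hCS := sq_integral_abs_mul_le (h.memLp_sqrt_mul (u x₀ ^ 2)) h.memLp_deriv
  rw [h.integral_sq_sqrt_mul hw hle] at hCS
  have hpi := pow_le_pow_left₀ (by positivity) (h.pi_div_two_le_integral hw) 2
  have hB : 0 ≤ ∫ x, u' x ^ 2 := integral_nonneg fun x => sq_nonneg _
  have hD : 0 ≤ ∫ x, |u x| ^ 6 := integral_nonneg fun x => by positivity
  generalize u x₀ ^ 2 = w at hw hle hCS hpi
  generalize (∫ x, u x ^ 2) = A at *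
  generalize (∫ x, u' x ^ 2) = B at *
  generalize (∫ x, |u x| ^ 6) = D at *
  have hmain : (π / 2) ^ 2 ≤ (4 / w ^ 2 * A - 4 / w ^ 4 * D) * B := hpi.trans hCS
  have hamgm : (4 / w ^ 2 * A - 4 / w ^ 4 * D) * D ≤ A ^ 2 := by
    have : A ^ 2 - (4 / w ^ 2 * A - 4 / w ^ 4 * D) * D = (A - 2 * D / w ^ 2) ^ 2 := by
      field_simp
      ring
    linarith [sq_nonneg (A - 2 * D / w ^ 2)]
  rw [div_mul_eq_mul_div, div_mul_eq_mul_div, le_div_iff₀ (by positivity)]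
  linarith [mul_le_mul_of_nonneg_right hmain hD, mul_le_mul_of_nonneg_right hamgm hB]

end H1line

/-- Modified Gagliardo–Nirenberg inequality on the line: there exists `C > 0` such
that for every `μ ∈ (0, μ_ℝ]` and every `u ∈ H¹_μ(ℝ)` there exists `θ ∈ [0, μ]` with
`∫ |u|⁶ ≤ 3 ((μ − θ)/μ_ℝ)² ∫ |u'|² + C θ^{1/2}`. -/
theorem modified_gagliardo_nirenberg_line :
    ∃ C : ℝ, 0 < C ∧ ∀ μ : ℝ, ∀ u u' : ℝ → ℝ,
      0 < μ → μ ≤ Real.pi * Real.sqrt 3 / 2 →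
      H1line u u' → (∫ x, (u x) ^ 2) = μ →
      ∃ θ : ℝ, θ ∈ Set.Icc 0 μ ∧
        (∫ x, |u x| ^ 6) ≤
          3 * ((μ - θ) / (Real.pi * Real.sqrt 3 / 2)) ^ 2 * (∫ x, (u' x) ^ 2) +
            C * Real.sqrt θ := by
  refine ⟨1, one_pos, fun μ u u' hμ _ h hA => ⟨0, ⟨le_rfl, hμ.le⟩, ?_⟩⟩
  have hGN := h.integral_abs_pow_six_le (hA ▸ hμ)
  have hconst : 3 * ((μ - 0) / (π * √3 / 2)) ^ 2 = 4 / π ^ 2 * μ ^ 2 := by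
    rw [sub_zero, div_pow, div_pow, mul_pow, Real.sq_sqrt (by norm_num)]
    field_simp
    ring
  rw [hconst, Real.sqrt_zero, mul_zero, add_zero]
  rwa [hA] at hGN
end

section
/- Pohozaev identity on the star graph: let p ∈ (2,6), α ∈ ℝ, λ ∈ ℝ and N ≥ 3. Let u₁, …, u_N : [0,∞) → ℝ be functions, each continuously differentiable on [0,∞) and twice differentiable on (0,∞), with u_i and u_i′ square-integrable on (0,∞), u_i(x) → 0 and u_i′(x) → 0 as x → ∞, satisfying the matching condition u₁(0) = ⋯ = u_N(0), the Kirchhoff condition Σ_{i=1}^N u_i′(0) = 0, and the stationary NLS equation −u_i″ + λ u_i = |u_i|⁴ u_i + α |u_i|^{p−2} u_i on (0,∞) for every i. Then Σ_{i=1}^N ∫₀^∞ |u_i′|² dx = Σ_{i=1}^N ∫₀^∞ ( (1/3)|u_i|⁶ + α ((p−2)/(2p)) |u_i|^p ) dx. -/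
open MeasureTheory Real Set Filter

/-- A function that is continuous on `[0,∞)`, square-integrable and vanishing at infinity lies in
every `L^q` with `2 ≤ q`. -/
theorem integrableOn_abs_rpow_of_sq {u : ℝ → ℝ} {q : ℝ} (hq : 2 ≤ q)
    (hc : ContinuousOn u (Ici 0)) (hu2 : IntegrableOn (fun x => (u x) ^ 2) (Ioi 0))
    (hu0 : Tendsto u atTop (nhds 0)) :
    IntegrableOn (fun x => |u x| ^ q) (Ioi 0) := by
  obtain ⟨R, hR⟩ := eventually_atTop.1 (hu0.eventually (Metric.ball_mem_nhds 0 one_pos))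
  obtain ⟨C, hC⟩ := (isCompact_Icc (a := (0 : ℝ)) (b := R)).exists_bound_of_continuousOn
    (hc.mono Icc_subset_Ici_self)
  have hM : ∀ x ∈ Ioi (0 : ℝ), |u x| ≤ max C 1 := by
    intro x hx
    rcases le_total x R with h | h
    · exact le_max_of_le_left (hC x ⟨le_of_lt hx, h⟩)
    · have := hR x h
      rw [dist_zero_right, Real.norm_eq_abs] at this
      exact le_max_of_le_right this.le
  refine Integrable.mono' (hu2.const_mul (max C 1 ^ (q - 2))) ?_ ?_
  · refine ContinuousOn.aestronglyMeasurable ?_ measurableSet_Ioi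
    exact ((hc.mono Ioi_subset_Ici_self).abs).rpow_const fun x _ => Or.inr (by linarith)
  · refine (ae_restrict_mem measurableSet_Ioi).mono fun x hx => ?_
    rw [Real.norm_eq_abs, abs_of_nonneg (by positivity)]
    have hsplit : |u x| ^ q = |u x| ^ (q - 2) * u x ^ 2 := by
      have h := Real.rpow_add_of_nonneg (abs_nonneg (u x)) (sub_nonneg.2 hq) (zero_le_two)
      rw [sub_add_cancel, Real.rpow_two, sq_abs] at h
      exact h
    rw [hsplit]
    gcongr
    exact hM x hx

/-- The conserved energy of a decaying solution of the stationary NLS equation vanishes. -/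
theorem stationary_nls_energy_eq_zero {p α lam : ℝ} (hp : 2 < p) {u u' u'' : ℝ → ℝ}
    (hderiv : ∀ x ∈ Ioi (0 : ℝ), HasDerivAt u (u' x) x)
    (hderiv2 : ∀ x ∈ Ioi (0 : ℝ), HasDerivAt u' (u'' x) x)
    (hu0 : Tendsto u atTop (nhds 0)) (hu'0 : Tendsto u' atTop (nhds 0))
    (heq : ∀ x ∈ Ioi (0 : ℝ),
      -(u'' x) + lam * u x = |u x| ^ 4 * u x + α * |u x| ^ (p - 2) * u x)
    {a : ℝ} (ha : 0 < a) :
    3 * u' a ^ 2 - 3 * lam * u a ^ 2 + u a ^ 6 + 6 * α / p * |u a| ^ p = 0 := by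
  set E : ℝ → ℝ := fun x =>
    3 * u' x ^ 2 - 3 * lam * u x ^ 2 + u x ^ 6 + 6 * α / p * |u x| ^ p with hE
  have hE' : ∀ x ∈ Ioi (0 : ℝ), HasDerivAt E 0 x := by
    intro x hx
    have h1 := hderiv x hx
    have h2 := hderiv2 x hx
    have h3 := (hasDerivAt_abs_rpow (u x) (by linarith : 1 < p)).comp x h1
    have h := ((((h2.pow 2).const_mul 3).sub ((h1.pow 2).const_mul (3 * lam))).add
      (h1.pow 6)).add (h3.const_mul (6 * α / p))
    refine h.congr_deriv ?_
    have he := heq x hx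
    have h4 : |u x| ^ 4 = u x ^ 4 := Even.pow_abs (by decide) _
    rw [h4] at he
    have hp0 : p ≠ 0 := by linarith
    field_simp
    push_cast
    linear_combination (-6 * u' x) * he
  have hlim : Tendsto E atTop (nhds 0) := by
    have h3 : Tendsto (fun x => |u x| ^ p) atTop (nhds 0) := by
      have := (hu0.abs).rpow_const (p := p) (Or.inr (by linarith))
      simpa [Real.zero_rpow (by linarith : p ≠ 0)] using this
    have h := ((((hu'0.pow 2).const_mul 3).sub ((hu0.pow 2).const_mul (3 * lam))).add
      (hu0.pow 6)).add (h3.const_mul (6 * α / p))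
    simpa [hE] using h
  have h := integral_Ioi_of_hasDerivAt_of_tendsto (a := a) (f' := fun _ => 0)
    (hE' a ha).continuousAt.continuousWithinAt
    (fun x hx => hE' x (ha.trans hx)) integrableOn_zero hlim
  simp only [integral_zero, zero_sub] at h
  linarith

/-- The Pohozaev identity on a single half-line, including the boundary term. -/
theorem pohozaev_identity_half_line {p α lam : ℝ} (hp : 2 < p) {u u' u'' : ℝ → ℝ}
    (hderiv : ∀ x ∈ Ici (0 : ℝ), HasDerivWithinAt u (u' x) (Ici 0) x)
    (hderivCont : ContinuousOn u' (Ici 0))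
    (hderiv2 : ∀ x ∈ Ioi (0 : ℝ), HasDerivAt u' (u'' x) x)
    (hu2 : IntegrableOn (fun x => (u x) ^ 2) (Ioi 0))
    (hu'2 : IntegrableOn (fun x => (u' x) ^ 2) (Ioi 0))
    (hu0 : Tendsto u atTop (nhds 0)) (hu'0 : Tendsto u' atTop (nhds 0))
    (heq : ∀ x ∈ Ioi (0 : ℝ),
      -(u'' x) + lam * u x = |u x| ^ 4 * u x + α * |u x| ^ (p - 2) * u x) :
    ∫ x in Ioi (0 : ℝ), (u' x) ^ 2 =
      (∫ x in Ioi (0 : ℝ), (1 / 3 * |u x| ^ 6 + α * ((p - 2) / (2 * p)) * |u x| ^ p))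
        - u 0 * u' 0 / 2 := by
  have hc : ContinuousOn u (Ici 0) := fun x hx => (hderiv x hx).continuousWithinAt
  have hd : ∀ x ∈ Ioi (0 : ℝ), HasDerivAt u (u' x) x := fun x hx =>
    (hderiv x (Ioi_subset_Ici_self hx)).hasDerivAt (Ici_mem_nhds hx)
  have h6 : IntegrableOn (fun x => |u x| ^ 6) (Ioi 0) := by
    have h := integrableOn_abs_rpow_of_sq (q := (6 : ℕ)) (by norm_num) hc hu2 hu0
    simpa only [Real.rpow_natCast] using h
  have hr : IntegrableOn
      (fun x => 1 / 3 * |u x| ^ 6 + α * ((p - 2) / (2 * p)) * |u x| ^ p) (Ioi 0) :=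
    (h6.const_mul _).add ((integrableOn_abs_rpow_of_sq hp.le hc hu2 hu0).const_mul _)
  have hF : ∀ x ∈ Ioi (0 : ℝ), HasDerivAt (fun x => u x * u' x / 2)
      (u' x ^ 2 - (1 / 3 * |u x| ^ 6 + α * ((p - 2) / (2 * p)) * |u x| ^ p)) x := by
    intro x hx
    refine (((hd x hx).mul (hderiv2 x hx)).div_const 2).congr_deriv ?_
    have hen := stationary_nls_energy_eq_zero hp hd hderiv2 hu0 hu'0 heq hx
    have he := heq x hx
    have h4 : |u x| ^ 4 = u x ^ 4 := Even.pow_abs (by decide) _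
    have h6 : |u x| ^ 6 = u x ^ 6 := Even.pow_abs (by decide) _
    have hsplit : |u x| ^ p = |u x| ^ (p - 2) * u x ^ 2 := by
      have h := Real.rpow_add_of_nonneg (abs_nonneg (u x)) (sub_nonneg.2 hp.le) (zero_le_two)
      rw [sub_add_cancel, Real.rpow_two, sq_abs] at h
      exact h
    rw [h4] at he
    rw [hsplit] at hen ⊢
    rw [h6]
    have hp0 : p ≠ 0 := by linarith
    field_simp at hen ⊢
    linear_combination (-3 * p * u x) * he - hen
  have h := integral_Ioi_of_hasDerivAt_of_tendsto (a := 0) (m := 0)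
    (((hc.mul hderivCont).div_const 2) 0 self_mem_Ici) hF (hu'2.sub hr)
    (by simpa using (hu0.mul hu'0).div_const 2)
  rw [integral_sub hu'2 hr, Pi.mul_apply] at h
  linarith

/-- Pohozaev identity on the star graph with `N ≥ 3` half-lines: for a stationary
state `u = (u₁, …, u_N)` of the NLS equation with combined nonlinearities,
satisfying the matching and Kirchhoff conditions at the origin, one has
`Σᵢ ∫₀^∞ |uᵢ'|² = Σᵢ ∫₀^∞ ((1/3)|uᵢ|⁶ + α ((p−2)/(2p)) |uᵢ|^p)`. -/
theorem pohozaev_identity_star_graph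
    (p α lam : ℝ) (hp : 2 < p) (hp' : p < 6)
    (N : ℕ) (hN : 3 ≤ N)
    (u u' u'' : Fin N → ℝ → ℝ)
    -- each `uᵢ` is continuously differentiable on `[0,∞)` with derivative `uᵢ'`
    (hderiv : ∀ i, ∀ x ∈ Set.Ici (0 : ℝ), HasDerivWithinAt (u i) (u' i x) (Set.Ici 0) x)
    (hderivCont : ∀ i, ContinuousOn (u' i) (Set.Ici 0))
    -- each `uᵢ` is twice differentiable on `(0,∞)` with second derivative `uᵢ''`
    (hderiv2 : ∀ i, ∀ x ∈ Set.Ioi (0 : ℝ), HasDerivAt (u' i) (u'' i x) x)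
    -- square-integrability of `uᵢ` and `uᵢ'` on `(0,∞)`
    (hu2 : ∀ i, IntegrableOn (fun x => (u i x) ^ 2) (Set.Ioi 0))
    (hu'2 : ∀ i, IntegrableOn (fun x => (u' i x) ^ 2) (Set.Ioi 0))
    -- decay at infinity
    (hu0 : ∀ i, Filter.Tendsto (u i) Filter.atTop (nhds 0))
    (hu'0 : ∀ i, Filter.Tendsto (u' i) Filter.atTop (nhds 0))
    -- matching condition at the common origin
    (hmatch : ∀ i j, u i 0 = u j 0)
    -- Kirchhoff condition
    (hkirchhoff : ∑ i : Fin N, u' i 0 = 0)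
    -- stationary NLS equation with combined nonlinearities on each half-line
    (heq : ∀ i, ∀ x ∈ Set.Ioi (0 : ℝ),
      -(u'' i x) + lam * u i x = |u i x| ^ 4 * u i x + α * |u i x| ^ (p - 2) * u i x) :
    ∑ i : Fin N, ∫ x in Set.Ioi (0 : ℝ), (u' i x) ^ 2 =
      ∑ i : Fin N, ∫ x in Set.Ioi (0 : ℝ),
        (1 / 3 * |u i x| ^ 6 + α * ((p - 2) / (2 * p)) * |u i x| ^ p) := by
  have h := fun i => pohozaev_identity_half_line hp (hderiv i) (hderivCont i) (hderiv2 i)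
    (hu2 i) (hu'2 i) (hu0 i) (hu'0 i) (heq i)
  have hb : ∑ i, u i 0 * u' i 0 / 2 = 0 := by
    let j : Fin N := ⟨0, by omega⟩
    calc ∑ i, u i 0 * u' i 0 / 2 = ∑ i, u j 0 / 2 * u' i 0 :=
          Finset.sum_congr rfl fun i _ => by rw [hmatch i j]; ring
      _ = 0 := by rw [← Finset.mul_sum, hkirchhoff, mul_zero]
  rw [Finset.sum_congr rfl fun i _ => h i, Finset.sum_sub_distrib, hb, sub_zero]
end
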